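/- Weak-type bound for the complexity-$u$ square function: for every integer $u \ge 0$, the square function $S_u f = \big(\sum_{P \in \mathcal D} \langle |D_{i_P - u} f| \rangle_{3P}^2 \mathbf 1_P\big)^{1/2}$ satisfies $\|S_u f\|_{L^{1,\infty}} \lesssim (1+u)\|f\|_{L^1}$, with implied constant depending only on the dimension $d$. -/

import Mathlib

open MeasureTheory Set
open scoped ENNReal

noncomputable section

/-- The standard dyadic cube of scale `2^k` with index `m ∈ ℤ^d`. -/
def dSet (d : ℕ) (k : ℤ) (m : Fin d → ℤ) : Set (Fin d → ℝ) :=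
  {x | ∀ i, (m i : ℝ) * 2 ^ k ≤ x i ∧ x i < ((m i : ℝ) + 1) * 2 ^ k}

/-- The concentric triple `3P` of the dyadic cube of scale `2^k`, index `m`. -/
def dTri (d : ℕ) (k : ℤ) (m : Fin d → ℤ) : Set (Fin d → ℝ) :=
  {x | ∀ i, ((m i : ℝ) - 1) * 2 ^ k ≤ x i ∧ x i < ((m i : ℝ) + 2) * 2 ^ k}

/-- The average `⟨f⟩_A = |A|⁻¹ ∫_A f`. -/
def savg (d : ℕ) (A : Set (Fin d → ℝ)) (f : (Fin d → ℝ) → ℝ) : ℝ :=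
  (volume A).toReal⁻¹ * ∫ x in A, f x

/-- Index of the dyadic cube of scale `2^k` containing `x`. -/
def dIdx (d : ℕ) (k : ℤ) (x : Fin d → ℝ) : Fin d → ℤ :=
  fun i => ⌊x i / 2 ^ k⌋

/-- Conditional expectation of `f` at scale `2^k`. -/
def Ek (d : ℕ) (k : ℤ) (f : (Fin d → ℝ) → ℝ) (x : Fin d → ℝ) : ℝ :=
  savg d (dSet d k (dIdx d k x)) f

/-- Martingale difference at scale `2^k`: `D_k f = ∑_{ℓP = 2^k} Δ_P f`. -/
def Dk (d : ℕ) (k : ℤ) (f : (Fin d → ℝ) → ℝ) (x : Fin d → ℝ) : ℝ :=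
  Ek d (k - 1) f x - Ek d k f x

/-- The complexity-`u` square function
`S_u f = (∑_P ⟨|D_{i_P-u} f|⟩_{3P}² 1_P)^{1/2}`; for each scale there is a
unique dyadic cube containing `x`. -/
def squareFn (d : ℕ) (u : ℕ) (f : (Fin d → ℝ) → ℝ) (x : Fin d → ℝ) : ℝ :=
  Real.sqrt (∑' k : ℤ,
    (savg d (dTri d k (dIdx d k x)) (fun y => |Dk d (k - (u : ℤ)) f y|)) ^ 2)

section helpers

variable {d : ℕ}

lemma mem_dSet_iff (k : ℤ) (m : Fin d → ℤ) (y : Fin d → ℝ) :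
    y ∈ dSet d k m ↔ dIdx d k y = m := by
  have h2 : (0 : ℝ) < 2 ^ k := by positivity
  simp only [dSet, mem_ofPred_eq, dIdx, funext_iff, Int.floor_eq_iff, le_div_iff₀ h2, div_lt_iff₀ h2]

lemma mem_dTri_iff (k : ℤ) (m : Fin d → ℤ) (y : Fin d → ℝ) :
    y ∈ dTri d k m ↔ ∀ i, m i - 1 ≤ dIdx d k y i ∧ dIdx d k y i ≤ m i + 1 := by
  have h2 : (0 : ℝ) < 2 ^ k := by positivity
  simp only [dTri, mem_ofPred_eq, dIdx]
  refine forall_congr' fun i => and_congr ?_ ?_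
  · rw [Int.le_floor, le_div_iff₀ h2]; push_cast; rfl
  · rw [← Int.lt_add_one_iff, Int.floor_lt, div_lt_iff₀ h2]; push_cast
    rw [add_assoc]; norm_num

lemma dIdx_succ (k : ℤ) (x : Fin d → ℝ) (i : Fin d) :
    dIdx d (k + 1) x i = dIdx d k x i / 2 := by
  simp only [dIdx]
  rw [zpow_add₀ (by norm_num), zpow_one, ← div_div]
  have := Int.floor_div_natCast (x i / 2 ^ k) 2
  simpa using this

lemma dIdx_eq_mono {k j : ℤ} (h : k ≤ j) {x y : Fin d → ℝ} (hxy : dIdx d k y = dIdx d k x) :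
    dIdx d j y = dIdx d j x := by
  induction j, h using Int.leInduction with
  | base => exact hxy
  | succ n _ ih => funext i; rw [dIdx_succ, dIdx_succ, ih]

/-- The dyadic cube around x. -/
def cell (d : ℕ) (k : ℤ) (x : Fin d → ℝ) : Set (Fin d → ℝ) := dSet d k (dIdx d k x)

/-- The tripled dyadic cube around x. -/
def tri (d : ℕ) (k : ℤ) (x : Fin d → ℝ) : Set (Fin d → ℝ) := dTri d k (dIdx d k x)

lemma mem_cell {k : ℤ} {x y : Fin d → ℝ} : y ∈ cell d k x ↔ dIdx d k y = dIdx d k x :=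
  mem_dSet_iff _ _ _

lemma mem_tri {k : ℤ} {x y : Fin d → ℝ} : y ∈ tri d k x ↔
    ∀ i, dIdx d k x i - 1 ≤ dIdx d k y i ∧ dIdx d k y i ≤ dIdx d k x i + 1 :=
  mem_dTri_iff _ _ _

lemma tri_mono {k j : ℤ} (h : k ≤ j) {x y : Fin d → ℝ} (hxy : y ∈ tri d k x) :
    y ∈ tri d j x := by
  induction j, h using Int.leInduction with
  | base => exact hxy
  | succ n _ ih =>
    rw [mem_tri] at ih ⊢
    intro i
    have := ih i
    rw [dIdx_succ, dIdx_succ]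
    omega

lemma cell_subset_tri {k : ℤ} {x y : Fin d → ℝ} (hy : y ∈ tri d k x) :
    cell d k y ⊆ tri d k x := by
  intro z hz
  rw [mem_cell] at hz
  rw [mem_tri] at hy ⊢
  rw [hz]; exact hy

lemma measurable_dIdx (k : ℤ) : Measurable (dIdx d k) := by
  refine measurable_pi_lambda _ fun i => ?_
  exact Int.measurable_floor.comp ((measurable_pi_apply i).div_const _)

/-- volume of a cube -/
def cvol (d : ℕ) (k : ℤ) : ℝ≥0∞ := ENNReal.ofReal (2 ^ k) ^ d

lemma volume_cell (k : ℤ) (x : Fin d → ℝ) : volume (cell d k x) = cvol d k := by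
  have : cell d k x = Set.pi univ (fun i => Ico ((dIdx d k x i : ℝ) * 2 ^ k)
      (((dIdx d k x i : ℝ) + 1) * 2 ^ k)) := by
    ext y; simp [cell, dSet]
  rw [this, volume_pi_pi]
  simp [Real.volume_Ico, add_mul, cvol]

lemma volume_tri (k : ℤ) (x : Fin d → ℝ) : volume (tri d k x) = 3 ^ d * cvol d k := by
  have : tri d k x = Set.pi univ (fun i => Ico (((dIdx d k x i : ℝ) - 1) * 2 ^ k)
      (((dIdx d k x i : ℝ) + 2) * 2 ^ k)) := by
    ext y; simp [tri, dTri]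
  rw [this, volume_pi_pi]
  have h (i : Fin d) : (((dIdx d k x i : ℝ) + 2) * 2 ^ k) - (((dIdx d k x i : ℝ) - 1) * 2 ^ k)
    = 3 * 2 ^ k := by ring
  simp [Real.volume_Ico, h, cvol, ENNReal.ofReal_mul, mul_pow]

lemma cvol_ne_zero (k : ℤ) : cvol d k ≠ 0 := by
  have : (0 : ℝ) < 2 ^ k := by positivity
  simp [cvol, this]

lemma cvol_ne_top (k : ℤ) : cvol d k ≠ ⊤ := by
  simp [cvol]

lemma tvol_ne_zero (k : ℤ) : 3 ^ d * cvol d k ≠ 0 := by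
  simp [cvol_ne_zero]

lemma tvol_ne_top (k : ℤ) : 3 ^ d * cvol d k ≠ ⊤ :=
  ENNReal.mul_ne_top (by simp) (cvol_ne_top k)

lemma cvol_succ (k : ℤ) : cvol d (k + 1) = 2 ^ d * cvol d k := by
  rw [cvol, cvol, zpow_add₀ (by norm_num), mul_comm, ENNReal.ofReal_mul (by norm_num), mul_pow]
  simp

lemma measurableSet_cell (k : ℤ) (x : Fin d → ℝ) : MeasurableSet (cell d k x) := by
  have : cell d k x = dIdx d k ⁻¹' {dIdx d k x} := by ext y; simp [mem_cell]
  rw [this]; exact measurable_dIdx k (measurableSet_singleton _)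

lemma measurableSet_tri (k : ℤ) (x : Fin d → ℝ) : MeasurableSet (tri d k x) := by
  have : tri d k x = dIdx d k ⁻¹' {m | ∀ i, dIdx d k x i - 1 ≤ m i ∧ m i ≤ dIdx d k x i + 1} := by
    ext y; simp [mem_tri]
  rw [this]; exact measurable_dIdx k (Set.to_countable _).measurableSet

lemma measurable_factor {β : Type*} [MeasurableSpace β] (k : ℤ) (g : (Fin d → ℝ) → β)
    (hg : ∀ x y, dIdx d k y = dIdx d k x → g y = g x) : Measurable g := by
  by_cases hne : Nonempty β
  · have : g = (Function.extend (dIdx d k) g (fun _ => hne.some)) ∘ dIdx d k := by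
      funext x
      simp only [Function.comp]
      exact (Function.FactorsThrough.extend_apply (fun a b h => hg b a h) _ x).symm
    rw [this]
    exact (measurable_of_countable _).comp (measurable_dIdx k)
  · have : IsEmpty (Fin d → ℝ) := ⟨fun x => hne ⟨g x⟩⟩
    exact measurable_of_countable _

lemma measurableSet_prod_cell (k : ℤ) :
    MeasurableSet {p : (Fin d → ℝ) × (Fin d → ℝ) | p.2 ∈ cell d k p.1} := by
  have : {p : (Fin d → ℝ) × (Fin d → ℝ) | p.2 ∈ cell d k p.1} =
     (Prod.map (dIdx d k) (dIdx d k)) ⁻¹' {q | q.2 = q.1} := by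
    ext p; simp [mem_cell]
  rw [this]
  exact ((measurable_dIdx k).prodMap (measurable_dIdx k)) (Set.to_countable _).measurableSet

lemma measurableSet_prod_tri (k : ℤ) :
    MeasurableSet {p : (Fin d → ℝ) × (Fin d → ℝ) | p.2 ∈ tri d k p.1} := by
  have : {p : (Fin d → ℝ) × (Fin d → ℝ) | p.2 ∈ tri d k p.1} =
     (Prod.map (dIdx d k) (dIdx d k)) ⁻¹' {q | ∀ i, q.1 i - 1 ≤ q.2 i ∧ q.2 i ≤ q.1 i + 1} := by
    ext p; simp [mem_tri]
  rw [this]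
  exact ((measurable_dIdx k).prodMap (measurable_dIdx k)) (Set.to_countable _).measurableSet

/-- averaging operator -/
def lav {α : Type*} [MeasureSpace α] (s : α → Set α) (V : ℝ≥0∞) (h : α → ℝ≥0∞) (x : α) : ℝ≥0∞ :=
  V⁻¹ * ∫⁻ y in s x, h y

lemma lintegral_lav {α : Type*} [MeasureSpace α] [SFinite (volume : Measure α)]
    (s : α → Set α) (V : ℝ≥0∞)
    (hs : MeasurableSet {p : α × α | p.2 ∈ s p.1})
    (hsym : ∀ x y, y ∈ s x → x ∈ s y) (hV : ∀ x, volume (s x) = V)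
    (h0 : V ≠ 0) (ht : V ≠ ⊤) (h : α → ℝ≥0∞) (hm : AEMeasurable h) :
    ∫⁻ x, lav s V h x = ∫⁻ x, h x := by
  have hsx (x : α) : MeasurableSet (s x) := measurable_prodMk_left hs
  have e1 (x : α) : ∫⁻ y in s x, h y = ∫⁻ y, (s x).indicator h y :=
    (lintegral_indicator (hsx x) _).symm
  simp only [lav]
  rw [lintegral_const_mul' _ _ (by simp [h0])]
  simp only [e1]
  rw [lintegral_lintegral_swap]
  · have e2 (y : α) : ∫⁻ x, (s x).indicator h y = V * h y := by
      have : (fun x => (s x).indicator h y) = (s y).indicator (fun _ => h y) := by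
        funext x
        by_cases hxy : y ∈ s x
        · simp [hxy, hsym _ _ hxy]
        · have : x ∉ s y := fun h' => hxy (hsym _ _ h')
          simp [hxy, this]
      rw [this, lintegral_indicator (hsx y), setLIntegral_const, hV, mul_comm]
    simp only [e2]
    rw [lintegral_const_mul' _ _ ht, ← mul_assoc, ENNReal.inv_mul_cancel h0 ht, one_mul]
  · have : (Function.uncurry fun x y => (s x).indicator h y) =
      {p : α × α | p.2 ∈ s p.1}.indicator (fun p => h p.2) := by
      funext p; simp [Set.indicator, Function.uncurry]
    rw [this]
    exact (hm.comp_snd).indicator hs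

lemma cell_symm (k : ℤ) (x y : Fin d → ℝ) (h : y ∈ cell d k x) : x ∈ cell d k y := by
  rw [mem_cell] at *; exact h.symm

lemma tri_symm (k : ℤ) (x y : Fin d → ℝ) (h : y ∈ tri d k x) : x ∈ tri d k y := by
  rw [mem_tri] at *; intro i; have := h i; omega

/-- lower-case averaging over cells -/
def cAv (k : ℤ) (h : (Fin d → ℝ) → ℝ≥0∞) : (Fin d → ℝ) → ℝ≥0∞ := lav (cell d k) (cvol d k) h

/-- averaging over triples -/
def tAv (k : ℤ) (h : (Fin d → ℝ) → ℝ≥0∞) : (Fin d → ℝ) → ℝ≥0∞ :=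
  lav (tri d k) (3 ^ d * cvol d k) h

lemma lintegral_cAv (k : ℤ) {h : (Fin d → ℝ) → ℝ≥0∞} (hm : AEMeasurable h) :
    ∫⁻ x, cAv k h x = ∫⁻ x, h x :=
  lintegral_lav _ _ (measurableSet_prod_cell k) (cell_symm k) (volume_cell k) (cvol_ne_zero k)
    (cvol_ne_top k) h hm

lemma lintegral_tAv (k : ℤ) {h : (Fin d → ℝ) → ℝ≥0∞} (hm : AEMeasurable h) :
    ∫⁻ x, tAv k h x = ∫⁻ x, h x :=
  lintegral_lav _ _ (measurableSet_prod_tri k) (tri_symm k) (volume_tri k) (tvol_ne_zero k)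
    (tvol_ne_top k) h hm

lemma cell_congr {k : ℤ} {x y : Fin d → ℝ} (h : dIdx d k y = dIdx d k x) :
    cell d k y = cell d k x := by simp [cell, h]

lemma tri_congr {k : ℤ} {x y : Fin d → ℝ} (h : dIdx d k y = dIdx d k x) :
    tri d k y = tri d k x := by simp [tri, h]

lemma cAv_congr {k : ℤ} (g : (Fin d → ℝ) → ℝ≥0∞) {x y : Fin d → ℝ} (h : dIdx d k y = dIdx d k x) :
    cAv k g y = cAv k g x := by simp only [cAv, lav, cell_congr h]

lemma measurable_cAv (k : ℤ) (h : (Fin d → ℝ) → ℝ≥0∞) : Measurable (cAv k h) :=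
  measurable_factor k _ fun _ _ hxy => cAv_congr h hxy

lemma measurable_tAv (k : ℤ) (h : (Fin d → ℝ) → ℝ≥0∞) : Measurable (tAv k h) :=
  measurable_factor k _ fun x y hxy => by simp only [tAv, lav, tri_congr hxy]

/-- invariance of a set at scale `k` -/
def DInv (k : ℤ) (S : Set (Fin d → ℝ)) : Prop :=
  ∀ x y, dIdx d k y = dIdx d k x → x ∈ S → y ∈ S

lemma DInv.mono {k j : ℤ} (h : k ≤ j) {S : Set (Fin d → ℝ)} (hS : DInv j S) : DInv k S :=
  fun x y hxy hx => hS x y (dIdx_eq_mono h hxy) hx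

lemma DInv.measurableSet {k : ℤ} {S : Set (Fin d → ℝ)} (hS : DInv k S) : MeasurableSet S := by
  have : Measurable (fun x => x ∈ S) := measurable_factor k _ fun x y hxy =>
    propext ⟨fun h => hS _ _ hxy.symm h, fun h => hS _ _ hxy h⟩
  exact measurableSet_setOfPred.2 this

lemma cAv_indicator {k : ℤ} {S : Set (Fin d → ℝ)} (hS : DInv k S) (h : (Fin d → ℝ) → ℝ≥0∞) :
    cAv k (S.indicator h) = S.indicator (cAv k h) := by
  funext x
  by_cases hx : x ∈ S
  · simp only [cAv, lav, Set.indicator_of_mem hx]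
    congr 1
    refine setLIntegral_congr_fun (measurableSet_cell k x) fun y hy => ?_
    exact Set.indicator_of_mem (hS _ _ (mem_cell.1 hy) hx) _
  · simp only [cAv, lav, Set.indicator_of_notMem hx]
    rw [setLIntegral_congr_fun (g := fun _ => 0) (measurableSet_cell k x) fun y hy => ?_]
    · simp
    · exact Set.indicator_of_notMem (fun hy' => hx (hS _ _ (mem_cell.1 hy).symm hy')) _

lemma setLIntegral_cAv {k : ℤ} {S : Set (Fin d → ℝ)} (hS : DInv k S) {h : (Fin d → ℝ) → ℝ≥0∞}
    (hm : AEMeasurable h) : ∫⁻ x in S, cAv k h x = ∫⁻ x in S, h x := by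
  rw [← lintegral_indicator hS.measurableSet, ← lintegral_indicator hS.measurableSet,
    ← cAv_indicator hS, lintegral_cAv k (hm.indicator hS.measurableSet)]

lemma tAv_sq_le (k : ℤ) {h : (Fin d → ℝ) → ℝ≥0∞} (hm : AEMeasurable h) (x : Fin d → ℝ) :
    tAv k h x ^ 2 ≤ tAv k (fun y => h y ^ 2) x := by
  simp only [tAv, lav]
  set V := 3 ^ d * cvol d k with hV
  have h0 : V ≠ 0 := tvol_ne_zero k
  have ht : V ≠ ⊤ := tvol_ne_top k
  have key := ENNReal.lintegral_mul_le_Lp_mul_Lq (volume.restrict (tri d k x))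
    Real.HolderConjugate.two_two (f := h) (g := fun _ => 1) hm.restrict aemeasurable_const
  simp only [Pi.mul_apply, mul_one, ENNReal.one_rpow, one_mul, lintegral_const,
    Measure.restrict_apply_univ, volume_tri] at key
  rw [← hV] at key
  have key2 : (∫⁻ y in tri d k x, h y) ^ 2 ≤ (∫⁻ y in tri d k x, h y ^ 2) * V := by
    calc _ ≤ _ := pow_le_pow_left' key 2
      _ = _ := by
        rw [mul_pow, ← ENNReal.rpow_natCast, ← ENNReal.rpow_natCast, ← ENNReal.rpow_mul,
          ← ENNReal.rpow_mul]
        norm_num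
  calc (V⁻¹ * ∫⁻ y in tri d k x, h y) ^ 2 = V⁻¹ ^ 2 * (∫⁻ y in tri d k x, h y) ^ 2 := mul_pow _ _ _
    _ ≤ V⁻¹ ^ 2 * ((∫⁻ y in tri d k x, h y ^ 2) * V) := by gcongr
    _ = V⁻¹ * (V⁻¹ * V) * ∫⁻ y in tri d k x, h y ^ 2 := by ring
    _ = _ := by rw [ENNReal.inv_mul_cancel h0 ht, mul_one]

lemma enorm_savg_le (A : Set (Fin d → ℝ)) (V : ℝ≥0∞) (hA : volume A = V) (h0 : V ≠ 0)
    (g : (Fin d → ℝ) → ℝ) :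
    ‖savg d A g‖ₑ ≤ V⁻¹ * ∫⁻ y in A, ‖g y‖ₑ := by
  rw [savg, enorm_mul, hA]
  gcongr
  · rw [Real.enorm_eq_ofReal (by positivity), ← ENNReal.toReal_inv, ENNReal.ofReal_toReal (by simp [h0])]
  · exact enorm_integral_le_lintegral_enorm _

lemma enorm_Ek_le (k : ℤ) (f : (Fin d → ℝ) → ℝ) (x : Fin d → ℝ) :
    ‖Ek d k f x‖ₑ ≤ cAv k (fun y => ‖f y‖ₑ) x :=
  enorm_savg_le _ _ (volume_cell k x) (cvol_ne_zero k) f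

lemma Ek_congr {k : ℤ} (f : (Fin d → ℝ) → ℝ) {x y : Fin d → ℝ} (h : dIdx d k y = dIdx d k x) :
    Ek d k f y = Ek d k f x := by
  simp only [Ek, h]

lemma measurable_Ek (k : ℤ) (f : (Fin d → ℝ) → ℝ) : Measurable (Ek d k f) :=
  measurable_factor k _ fun _ _ h => Ek_congr f h

lemma measurable_Dk (k : ℤ) (f : (Fin d → ℝ) → ℝ) : Measurable (Dk d k f) :=
  (measurable_Ek _ _).sub (measurable_Ek _ _)

lemma integral_Ek {k : ℤ} {f : (Fin d → ℝ) → ℝ} (hf : Integrable f) {Q : Set (Fin d → ℝ)}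
    (hQ : DInv k Q) (hfin : volume Q ≠ ⊤) :
    ∫ x in Q, Ek d k f x = ∫ x in Q, f x := by
  have hQm := hQ.measurableSet
  have : IsFiniteMeasure (volume.restrict Q) := ⟨by simpa using hfin.lt_top⟩
  set v := (cvol d k).toReal with hv
  have hv0 : v ≠ 0 := by
    simp [hv, ENNReal.toReal_eq_zero_iff, cvol_ne_zero, cvol_ne_top]
  have e0 (x : Fin d → ℝ) : Ek d k f x = v⁻¹ * ∫ y, (cell d k x).indicator f y := by
    rw [integral_indicator (measurableSet_cell k x), hv, ← volume_cell k x]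
    rfl
  simp only [e0]
  rw [integral_const_mul, integral_integral_swap]
  · have e2 (y : Fin d → ℝ) : ∫ x in Q, (cell d k x).indicator f y = v * Q.indicator f y := by
      have h1 : (fun x => (cell d k x).indicator f y) = (cell d k y).indicator (fun _ => f y) := by
        funext x
        by_cases hxy : y ∈ cell d k x
        · simp [hxy, cell_symm _ _ _ hxy]
        · have : x ∉ cell d k y := fun h' => hxy (cell_symm _ _ _ h')
          simp [hxy, this]
      rw [h1, integral_indicator (measurableSet_cell k y), setIntegral_const, Measure.real,
        Measure.restrict_apply (measurableSet_cell k y), smul_eq_mul]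
      by_cases hy : y ∈ Q
      · have : cell d k y ∩ Q = cell d k y :=
          Set.inter_eq_left.2 fun z hz => hQ _ _ (mem_cell.1 hz) hy
        rw [this, volume_cell, Set.indicator_of_mem hy]
      · have : cell d k y ∩ Q = ∅ := by
          ext z
          simp only [mem_inter_iff, mem_empty_iff_false, iff_false, not_and]
          exact fun hz hzQ => hy (hQ _ _ (mem_cell.1 hz).symm hzQ)
        simp [this, hy]
    simp only [e2]
    rw [integral_const_mul, ← mul_assoc, inv_mul_cancel₀ hv0, one_mul, integral_indicator hQm]
  · have : (Function.uncurry fun x y => (cell d k x).indicator f y) =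
      {p : (Fin d → ℝ) × (Fin d → ℝ) | p.2 ∈ cell d k p.1}.indicator (fun p => f p.2) := by
      funext p; simp [Set.indicator, Function.uncurry]
    rw [this]
    exact (hf.comp_snd _).indicator (measurableSet_prod_cell k)

lemma DInv_cell (k : ℤ) (x : Fin d → ℝ) : DInv k (cell d k x) := by
  intro y z h hy
  rw [mem_cell] at *
  rw [h, hy]

lemma Ek_bounded (k : ℤ) {f : (Fin d → ℝ) → ℝ} (hf : Integrable f) :
    ∃ B : ℝ, ∀ x, |Ek d k f x| ≤ B := by
  have hN : ∫⁻ y, ‖f y‖ₑ ≠ ⊤ := hf.2.ne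
  have hB : (cvol d k)⁻¹ * ∫⁻ y, ‖f y‖ₑ ≠ ⊤ := ENNReal.mul_ne_top (by simp [cvol_ne_zero]) hN
  refine ⟨((cvol d k)⁻¹ * ∫⁻ y, ‖f y‖ₑ).toReal, fun x => ?_⟩
  rw [← Real.norm_eq_abs, ← toReal_enorm]
  refine ENNReal.toReal_mono hB ((enorm_Ek_le k f x).trans ?_)
  simp only [cAv, lav]
  gcongr
  exact Measure.restrict_le_self

lemma enorm_sq_eq (r : ℝ) : ‖r‖ₑ ^ 2 = ENNReal.ofReal (r ^ 2) := by
  rw [Real.enorm_eq_ofReal_abs, ← ENNReal.ofReal_pow (abs_nonneg _), sq_abs]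

lemma ortho (k : ℤ) {f : (Fin d → ℝ) → ℝ} (hf : Integrable f) (x : Fin d → ℝ) :
    cAv (k + 1) (fun y => ‖Dk d (k + 1) f y‖ₑ ^ 2) x + ‖Ek d (k + 1) f x‖ₑ ^ 2 =
      cAv (k + 1) (fun y => ‖Ek d k f y‖ₑ ^ 2) x := by
  obtain ⟨B, hB⟩ := Ek_bounded k hf
  set Q := cell d (k + 1) x with hQ
  set c := Ek d (k + 1) f x with hc
  have hVt : volume Q ≠ ⊤ := by rw [hQ, volume_cell]; exact cvol_ne_top _
  have hV0 : volume Q ≠ 0 := by rw [hQ, volume_cell]; exact cvol_ne_zero _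
  have hfin : IsFiniteMeasure (volume.restrict Q) := ⟨by simpa using hVt.lt_top⟩
  have hD : ∀ y ∈ Q, Dk d (k + 1) f y = Ek d k f y - c := by
    intro y hy
    rw [Dk, add_sub_cancel_right, hc, Ek_congr f (mem_cell.1 hy)]
  have i1 : Integrable (Ek d k f) (volume.restrict Q) :=
    Integrable.of_bound (measurable_Ek k f).aestronglyMeasurable B (ae_of_all _ hB)
  have i2 : Integrable (fun y => Ek d k f y ^ 2) (volume.restrict Q) :=
    Integrable.of_bound ((measurable_Ek k f).pow_const 2).aestronglyMeasurable (B ^ 2)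
      (ae_of_all _ fun y => by
        rw [Real.norm_eq_abs, abs_pow]
        exact pow_le_pow_left₀ (abs_nonneg _) (hB y) 2)
  have i3 : Integrable (fun y => (Ek d k f y - c) ^ 2) (volume.restrict Q) := by
    have : (fun y => (Ek d k f y - c) ^ 2) =
      fun y => Ek d k f y ^ 2 - 2 * c * Ek d k f y + c ^ 2 := by funext y; ring
    rw [this]
    exact (i2.sub (i1.const_mul _)).add (integrable_const _)
  have tower : ∫ y in Q, Ek d k f y = ∫ y in Q, f y :=
    integral_Ek hf ((DInv_cell (k + 1) x).mono (by omega)) hVt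
  have hv : 0 < (volume Q).toReal := ENNReal.toReal_pos hV0 hVt
  have hcv : ∫ y in Q, f y = (volume Q).toReal * c := by
    have : c = (volume Q).toReal⁻¹ * ∫ y in Q, f y := rfl
    rw [this, mul_inv_cancel_left₀ hv.ne']
  have main : (∫ y in Q, (Ek d k f y - c) ^ 2) + (volume Q).toReal * c ^ 2
      = ∫ y in Q, Ek d k f y ^ 2 := by
    have : (fun y => (Ek d k f y - c) ^ 2) =
      fun y => Ek d k f y ^ 2 - 2 * c * Ek d k f y + c ^ 2 := by funext y; ring
    rw [this, integral_add (f := fun y => Ek d k f y ^ 2 - 2 * c * Ek d k f y) (i2.sub (i1.const_mul _)) (integrable_const _),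
      integral_sub i2 (i1.const_mul _), integral_const_mul, tower, hcv, setIntegral_const,
      Measure.real, smul_eq_mul]
    ring
  have main2 : (∫⁻ y in Q, ‖Dk d (k + 1) f y‖ₑ ^ 2) + volume Q * ‖c‖ₑ ^ 2 =
      ∫⁻ y in Q, ‖Ek d k f y‖ₑ ^ 2 := by
    have e1 : ∫⁻ y in Q, ‖Dk d (k + 1) f y‖ₑ ^ 2 =
        ∫⁻ y in Q, ENNReal.ofReal ((Ek d k f y - c) ^ 2) := by
      refine setLIntegral_congr_fun (measurableSet_cell _ x) fun y hy => ?_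
      simp only [hD y hy, enorm_sq_eq]
    rw [e1]
    simp only [enorm_sq_eq]
    rw [← ofReal_integral_eq_lintegral_ofReal i3 (ae_of_all _ fun y => sq_nonneg _),
      ← ofReal_integral_eq_lintegral_ofReal i2 (ae_of_all _ fun y => sq_nonneg _), ← main,
      ENNReal.ofReal_add (integral_nonneg fun y => sq_nonneg _) (by positivity),
      ENNReal.ofReal_mul (by positivity), ENNReal.ofReal_toReal hVt]
  simp only [cAv, lav]
  rw [← hQ, ← main2, mul_add, ← mul_assoc, hQ, volume_cell,
    ENNReal.inv_mul_cancel (cvol_ne_zero _) (cvol_ne_top _), one_mul]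

/-- not yet stopped at scale `j` -/
def Aset (F : (Fin d → ℝ) → ℝ≥0∞) (L : ℝ≥0∞) (j : ℤ) : Set (Fin d → ℝ) :=
  {x | ∀ k, j ≤ k → cAv k F x ≤ L}

/-- stopped exactly at scale `j` -/
def Mset (F : (Fin d → ℝ) → ℝ≥0∞) (L : ℝ≥0∞) (j : ℤ) : Set (Fin d → ℝ) :=
  Aset F L (j + 1) \ Aset F L j

lemma DInv_Aset (F : (Fin d → ℝ) → ℝ≥0∞) (L : ℝ≥0∞) (j : ℤ) : DInv j (Aset F L j) := by
  intro x y hxy hx k hk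
  rw [cAv_congr F (dIdx_eq_mono hk hxy)]
  exact hx k hk

lemma DInv_Mset (F : (Fin d → ℝ) → ℝ≥0∞) (L : ℝ≥0∞) (j : ℤ) : DInv j (Mset F L j) := by
  intro x y hxy hx
  refine ⟨((DInv_Aset F L (j + 1)).mono (by omega)) x y hxy hx.1, fun hy => hx.2 ?_⟩
  exact DInv_Aset F L j y x hxy.symm hy

lemma Aset_mono (F : (Fin d → ℝ) → ℝ≥0∞) (L : ℝ≥0∞) {i j : ℤ} (h : i ≤ j) :
    Aset F L i ⊆ Aset F L j := fun _ hx k hk => hx k (h.trans hk)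

lemma Mset_disj (F : (Fin d → ℝ) → ℝ≥0∞) (L : ℝ≥0∞) :
    Pairwise (Function.onFun Disjoint (Mset F L)) := by
  have key : ∀ i j, i < j → Disjoint (Mset F L i) (Mset F L j) := by
    intro i j hij
    rw [Set.disjoint_left]
    intro x hx hx'
    exact hx'.2 (Aset_mono F L (by omega) hx.1)
  intro i j hij
  rcases lt_or_gt_of_ne hij with h | h
  · exact key i j h
  · exact (key j i h).symm

lemma tsum_Mset_le (F : (Fin d → ℝ) → ℝ≥0∞) (L : ℝ≥0∞) (g : (Fin d → ℝ) → ℝ≥0∞) :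
    ∑' i, ∫⁻ x in Mset F L i, g x ≤ ∫⁻ x, g x := by
  rw [← lintegral_iUnion (fun i => (DInv_Mset F L i).measurableSet) (Mset_disj F L)]
  exact setLIntegral_le_lintegral _ _

lemma exists_Mset (hd : d ≠ 0) (F : (Fin d → ℝ) → ℝ≥0∞) (L : ℝ≥0∞) (hL : L ≠ 0)
    (hF : ∫⁻ x, F x ≠ ⊤) {x : Fin d → ℝ} {j : ℤ} (hx : x ∉ Aset F L j) :
    ∃ i, j ≤ i ∧ x ∈ Mset F L i := by
  by_contra! hcon
  have hall : ∀ n, j ≤ n → x ∉ Aset F L n := by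
    intro n hn
    induction n, hn using Int.leInduction with
    | base => exact hx
    | succ n hn ih => exact fun h => hcon n hn ⟨h, ih⟩
  obtain ⟨n, hn⟩ := ENNReal.exists_nat_mul_gt hL hF
  refine hall (max j n) (le_max_left _ _) fun k hk => ?_
  have hk' : (n : ℤ) ≤ k := (le_max_right _ _).trans hk
  have h1 : (n : ℝ≥0∞) ≤ cvol d k := by
    have h2 : (n : ℝ) ≤ 2 ^ k := by
      calc (n : ℝ) ≤ 2 ^ n := by exact_mod_cast Nat.lt_two_pow_self.le
        _ = (2 : ℝ) ^ (n : ℤ) := by simp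
        _ ≤ 2 ^ k := zpow_le_zpow_right₀ (by norm_num) hk'
    have h3 : (1 : ℝ≥0∞) ≤ ENNReal.ofReal (2 ^ k) := by
      rw [ENNReal.one_le_ofReal]
      exact one_le_zpow₀ (by norm_num) (by omega)
    calc (n : ℝ≥0∞) = ENNReal.ofReal n := by simp
      _ ≤ ENNReal.ofReal (2 ^ k) := ENNReal.ofReal_le_ofReal h2
      _ ≤ _ := le_self_pow₀ h3 hd
  calc cAv k F x ≤ (cvol d k)⁻¹ * ∫⁻ x, F x := by
        simp only [cAv, lav]; gcongr; exact Measure.restrict_le_self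
    _ ≤ (cvol d k)⁻¹ * (cvol d k * L) := by
        gcongr; exact hn.le.trans (by gcongr)
    _ = L := by
        rw [← mul_assoc, ENNReal.inv_mul_cancel (cvol_ne_zero _) (cvol_ne_top _), one_mul]

lemma cAv_doubling (F : (Fin d → ℝ) → ℝ≥0∞) (k : ℤ) (x : Fin d → ℝ) :
    cAv k F x ≤ 2 ^ d * cAv (k + 1) F x := by
  have hsub : cell d k x ⊆ cell d (k + 1) x := fun y hy =>
    mem_cell.2 (dIdx_eq_mono (by omega) (mem_cell.1 hy))
  simp only [cAv, lav]
  rw [cvol_succ, ENNReal.mul_inv (by simp) (by simp), ← mul_assoc, ← mul_assoc,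
    ENNReal.mul_inv_cancel (by simp) (by simp), one_mul]
  gcongr

lemma Mset_le {F : (Fin d → ℝ) → ℝ≥0∞} {L : ℝ≥0∞} {j : ℤ} {x : Fin d → ℝ} (hx : x ∈ Mset F L j) :
    cAv j F x ≤ 2 ^ d * L :=
  (cAv_doubling F j x).trans (by gcongr; exact hx.1 _ le_rfl)

lemma Mset_ge {F : (Fin d → ℝ) → ℝ≥0∞} {L : ℝ≥0∞} {j : ℤ} {x : Fin d → ℝ} (hx : x ∈ Mset F L j) :
    L ≤ cAv j F x := by
  by_contra! h
  refine hx.2 fun k hk => ?_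
  rcases hk.eq_or_lt with rfl | hk
  · exact h.le
  · exact hx.1 k (by omega)

lemma volume_Mset_le {F : (Fin d → ℝ) → ℝ≥0∞} (hF : AEMeasurable F) (L : ℝ≥0∞) (j : ℤ) :
    L * volume (Mset F L j) ≤ ∫⁻ x in Mset F L j, F x := by
  rw [← setLIntegral_cAv (DInv_Mset F L j) hF, ← setLIntegral_const]
  exact setLIntegral_mono (measurable_cAv _ _) fun x hx => Mset_ge hx

/-- exceptional set, one scale -/
def Oset (F : (Fin d → ℝ) → ℝ≥0∞) (L : ℝ≥0∞) (j : ℤ) : Set (Fin d → ℝ) :=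
  {x | ∃ y ∈ tri d j x, y ∈ Mset F L j}

lemma volume_Oset_le (F : (Fin d → ℝ) → ℝ≥0∞) (L : ℝ≥0∞) (j : ℤ) :
    volume (Oset F L j) ≤ 3 ^ d * volume (Mset F L j) := by
  have hM := (DInv_Mset F L j).measurableSet
  have h1 : ∀ x ∈ Oset F L j, 1 ≤ 3 ^ d * tAv j ((Mset F L j).indicator 1) x := by
    rintro x ⟨y, hy, hyM⟩
    simp only [tAv, lav]
    have : cvol d j ≤ ∫⁻ z in tri d j x, (Mset F L j).indicator 1 z := by
      rw [← volume_cell j y, lintegral_indicator_one hM, Measure.restrict_apply hM]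
      refine measure_mono fun z hz => ⟨?_, cell_subset_tri hy hz⟩
      exact DInv_Mset F L j y z (mem_cell.1 hz) hyM
    calc (1 : ℝ≥0∞) = 3 ^ d * ((3 ^ d * cvol d j)⁻¹ * cvol d j) := by
          rw [ENNReal.mul_inv (by simp) (by simp), mul_assoc,
            ENNReal.inv_mul_cancel (cvol_ne_zero _) (cvol_ne_top _), mul_one,
            ENNReal.mul_inv_cancel (by simp) (by simp)]
      _ ≤ _ := by gcongr
  calc volume (Oset F L j)
      ≤ volume {x | 1 ≤ 3 ^ d * tAv j ((Mset F L j).indicator 1) x} := measure_mono h1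
    _ ≤ ∫⁻ x, 3 ^ d * tAv j ((Mset F L j).indicator 1) x := by
        have := mul_meas_ge_le_lintegral (μ := volume)
          ((measurable_tAv j ((Mset F L j).indicator 1)).const_mul (3 ^ d)) 1
        simpa using this
    _ = _ := by
        rw [lintegral_const_mul _ (measurable_tAv _ _),
          lintegral_tAv _ ((measurable_one.indicator hM).aemeasurable), lintegral_indicator_one hM]

lemma volume_O_le {F : (Fin d → ℝ) → ℝ≥0∞} (hF : AEMeasurable F) (L : ℝ≥0∞) :
    L * volume (⋃ j, Oset F L j) ≤ 3 ^ d * ∫⁻ x, F x := by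
  calc L * volume (⋃ j, Oset F L j) ≤ L * ∑' j, 3 ^ d * volume (Mset F L j) := by
        gcongr
        exact (measure_iUnion_le _).trans (ENNReal.tsum_le_tsum fun j => volume_Oset_le F L j)
    _ = 3 ^ d * ∑' j, L * volume (Mset F L j) := by
        rw [ENNReal.tsum_mul_left, ENNReal.tsum_mul_left]; ring
    _ ≤ 3 ^ d * ∑' j, ∫⁻ x in Mset F L j, F x := by
        gcongr with j; exact volume_Mset_le hF L j
    _ ≤ _ := by gcongr; exact tsum_Mset_le F L F

lemma good_step {f : (Fin d → ℝ) → ℝ} (hf : Integrable f) (L : ℝ≥0∞) (j : ℤ) :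
    (∫⁻ x in Aset (fun y => ‖f y‖ₑ) L (j + 1), ‖Dk d (j + 1) f x‖ₑ ^ 2) +
      ∫⁻ x in Aset (fun y => ‖f y‖ₑ) L (j + 1), ‖Ek d (j + 1) f x‖ₑ ^ 2 ≤
    (∫⁻ x in Aset (fun y => ‖f y‖ₑ) L j, ‖Ek d j f x‖ₑ ^ 2) +
      2 ^ d * L * ∫⁻ x in Mset (fun y => ‖f y‖ₑ) L j, ‖f x‖ₑ := by
  set F : (Fin d → ℝ) → ℝ≥0∞ := fun y => ‖f y‖ₑ with hFdef
  have hF : AEMeasurable F := hf.1.aemeasurable.enorm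
  have hA := DInv_Aset F L (j + 1)
  have hmD : Measurable (fun x => ‖Dk d (j + 1) f x‖ₑ ^ 2) := (measurable_Dk _ f).enorm.pow_const 2
  have hmE (j) : Measurable (fun x => ‖Ek d j f x‖ₑ ^ 2) := (measurable_Ek _ f).enorm.pow_const 2
  rw [← setLIntegral_cAv hA hmD.aemeasurable, ← lintegral_add_right _ (hmE _)]
  simp only [ortho j hf]
  rw [setLIntegral_cAv hA (hmE _).aemeasurable]
  have hun : Aset F L (j + 1) = Aset F L j ∪ Mset F L j := by
    rw [Mset, Set.union_sdiff_cancel (Aset_mono F L (by omega))]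
  rw [hun, lintegral_union (DInv_Mset F L j).measurableSet disjoint_sdiff_right]
  gcongr
  calc ∫⁻ x in Mset F L j, ‖Ek d j f x‖ₑ ^ 2 ≤ ∫⁻ x in Mset F L j, 2 ^ d * L * cAv j F x := by
        refine setLIntegral_mono ((measurable_cAv _ _).const_mul _) fun x hx => ?_
        rw [sq]
        exact mul_le_mul' ((enorm_Ek_le j f x).trans (Mset_le hx)) (enorm_Ek_le j f x)
    _ = _ := by
        rw [lintegral_const_mul _ (measurable_cAv _ _), setLIntegral_cAv (DInv_Mset F L j) hF]

lemma good_sum {f : (Fin d → ℝ) → ℝ} (hf : Integrable f) (L : ℝ≥0∞) (J : ℤ) (n : ℕ) :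
    (∑ i ∈ Finset.range n,
      ∫⁻ x in Aset (fun y => ‖f y‖ₑ) L (J + i + 1), ‖Dk d (J + i + 1) f x‖ₑ ^ 2) +
      ∫⁻ x in Aset (fun y => ‖f y‖ₑ) L (J + n), ‖Ek d (J + n) f x‖ₑ ^ 2 ≤
    (∫⁻ x in Aset (fun y => ‖f y‖ₑ) L J, ‖Ek d J f x‖ₑ ^ 2) +
      2 ^ d * L * ∑ i ∈ Finset.range n, ∫⁻ x in Mset (fun y => ‖f y‖ₑ) L (J + i), ‖f x‖ₑ := by
  induction n with
  | zero => simp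
  | succ n ih =>
    rw [Finset.sum_range_succ, Finset.sum_range_succ, mul_add]
    have := good_step hf L (J + n)
    push_cast
    rw [← add_assoc J, add_assoc (Finset.sum _ _)]
    refine (add_le_add_right this _).trans ?_
    rw [← add_assoc, ← add_assoc]
    exact add_le_add_left ih _

lemma good_tsum {f : (Fin d → ℝ) → ℝ} (hf : Integrable f) (L : ℝ≥0∞) :
    ∑' j, ∫⁻ x in Aset (fun y => ‖f y‖ₑ) L j, ‖Dk d j f x‖ₑ ^ 2 ≤
      (1 + 2 ^ d) * L * ∫⁻ x, ‖f x‖ₑ := by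
  have hF : AEMeasurable (fun y => ‖f y‖ₑ) := hf.1.aemeasurable.enorm
  rw [ENNReal.tsum_eq_iSup_sum]
  refine iSup_le fun s => ?_
  obtain ⟨J, n, hs⟩ : ∃ (J : ℤ) (n : ℕ), s ⊆ (Finset.range n).image (fun i : ℕ => J + i + 1) := by
    obtain ⟨a, ha⟩ := s.bddBelow
    obtain ⟨b, hb⟩ := s.bddAbove
    refine ⟨a - 1, (b - a + 1).toNat, fun x hx => ?_⟩
    have h1 := ha hx
    have h2 := hb hx
    simp only [Finset.mem_image, Finset.mem_range]
    exact ⟨(x - a).toNat, by omega, by omega⟩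
  have h1 : (∫⁻ x in Aset (fun y => ‖f y‖ₑ) L J, ‖Ek d J f x‖ₑ ^ 2) ≤ L * ∫⁻ x, ‖f x‖ₑ := by
    calc _ ≤ ∫⁻ x in Aset (fun y => ‖f y‖ₑ) L J, L * cAv J (fun y => ‖f y‖ₑ) x := by
          refine setLIntegral_mono ((measurable_cAv _ _).const_mul _) fun x hx => ?_
          rw [sq]
          exact mul_le_mul' ((enorm_Ek_le J f x).trans (hx J le_rfl)) (enorm_Ek_le J f x)
      _ ≤ ∫⁻ x, L * cAv J (fun y => ‖f y‖ₑ) x := setLIntegral_le_lintegral _ _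
      _ = _ := by rw [lintegral_const_mul _ (measurable_cAv _ _), lintegral_cAv _ hF]
  have h2 : ∑ i ∈ Finset.range n, ∫⁻ x in Mset (fun y => ‖f y‖ₑ) L (J + i), ‖f x‖ₑ ≤
      ∫⁻ x, ‖f x‖ₑ := by
    refine le_trans ?_ (tsum_Mset_le (fun y => ‖f y‖ₑ) L (fun y => ‖f y‖ₑ))
    have hinj : Function.Injective (fun i : ℕ => J + (i : ℤ)) := fun a b h => by
      simpa using h
    rw [← Finset.sum_image (g := fun i : ℕ => J + (i : ℤ))
      (f := fun j => ∫⁻ x in Mset (fun y => ‖f y‖ₑ) L j, ‖f x‖ₑ) hinj.injOn]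
    exact ENNReal.sum_le_tsum _
  calc _ ≤ ∑ j ∈ (Finset.range n).image (fun i : ℕ => J + i + 1),
        ∫⁻ x in Aset (fun y => ‖f y‖ₑ) L j, ‖Dk d j f x‖ₑ ^ 2 := Finset.sum_le_sum_of_subset hs
    _ = ∑ i ∈ Finset.range n,
      ∫⁻ x in Aset (fun y => ‖f y‖ₑ) L (J + i + 1), ‖Dk d (J + i + 1) f x‖ₑ ^ 2 := by
        rw [Finset.sum_image]
        intro a _ b _ h
        simpa using h
    _ ≤ _ := le_self_add.trans (good_sum hf L J n)
    _ ≤ L * (∫⁻ x, ‖f x‖ₑ) + 2 ^ d * L * ∫⁻ x, ‖f x‖ₑ := by gcongr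
    _ = _ := by ring

lemma bad_one {f : (Fin d → ℝ) → ℝ} (hf : Integrable f) (L : ℝ≥0∞) {i j : ℤ} (h : j ≤ i) :
    ∫⁻ x in Mset (fun y => ‖f y‖ₑ) L i, ‖Dk d j f x‖ₑ ≤
      2 * ∫⁻ x in Mset (fun y => ‖f y‖ₑ) L i, ‖f x‖ₑ := by
  have hF : AEMeasurable (fun y => ‖f y‖ₑ) := hf.1.aemeasurable.enorm
  have hI := DInv_Mset (fun y => ‖f y‖ₑ) L i
  calc _ ≤ ∫⁻ x in Mset (fun y => ‖f y‖ₑ) L i,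
        (cAv (j - 1) (fun y => ‖f y‖ₑ) x + cAv j (fun y => ‖f y‖ₑ) x) := by
        refine lintegral_mono fun x => ?_
        exact enorm_sub_le.trans (add_le_add (enorm_Ek_le _ f x) (enorm_Ek_le _ f x))
    _ = _ := by
        rw [lintegral_add_left (measurable_cAv _ _), setLIntegral_cAv (hI.mono (by omega)) hF,
          setLIntegral_cAv (hI.mono h) hF, two_mul]

lemma bad_tsum {f : (Fin d → ℝ) → ℝ} (hf : Integrable f) (L : ℝ≥0∞) (u : ℕ) :
    ∑' k : ℤ, ∫⁻ x in ⋃ n ∈ Finset.range u, Mset (fun y => ‖f y‖ₑ) L (k - u + n),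
      ‖Dk d (k - u) f x‖ₑ ≤ 2 * u * ∫⁻ x, ‖f x‖ₑ := by
  calc _ ≤ ∑' k : ℤ, ∑ n ∈ Finset.range u,
        2 * ∫⁻ x in Mset (fun y => ‖f y‖ₑ) L (k + (n - u)), ‖f x‖ₑ := by
        refine ENNReal.tsum_le_tsum fun k => ?_
        rw [lintegral_biUnion_finset (t := fun n : ℕ => Mset (fun y => ‖f y‖ₑ) L (k - u + n))
          (fun a _ b _ hab => Mset_disj (fun y => ‖f y‖ₑ) L (by simpa using hab))
          (fun n _ => (DInv_Mset _ _ _).measurableSet)]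
        refine Finset.sum_le_sum fun n _ => ?_
        have := bad_one hf L (i := k - u + n) (j := k - u) (by omega)
        rwa [show k + ((n : ℤ) - u) = k - u + n by ring]
    _ = ∑ n ∈ Finset.range u, ∑' k : ℤ,
        2 * ∫⁻ x in Mset (fun y => ‖f y‖ₑ) L (k + (n - u)), ‖f x‖ₑ :=
        Summable.tsum_finsetSum fun _ _ => ENNReal.summable
    _ ≤ ∑ n ∈ Finset.range u, 2 * ∫⁻ x, ‖f x‖ₑ := by
        refine Finset.sum_le_sum fun n _ => ?_
        rw [ENNReal.tsum_mul_left]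
        gcongr
        have := (Equiv.addRight ((n : ℤ) - u)).tsum_eq
          (fun k => ∫⁻ x in Mset (fun y => ‖f y‖ₑ) L k, ‖f x‖ₑ)
        simp only [Equiv.coe_addRight] at this
        rw [this]
        exact tsum_Mset_le _ _ _
    _ = _ := by simp; ring

lemma enn_add_sq_le (a b : ℝ≥0∞) : (a + b) ^ 2 ≤ 4 * a ^ 2 + 4 * b ^ 2 := by
  have key : ∀ a b : ℝ≥0∞, a ≤ b → (a + b) ^ 2 ≤ 4 * b ^ 2 := by
    intro a b h
    calc (a + b) ^ 2 ≤ (b + b) ^ 2 := by gcongr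
      _ = 4 * b ^ 2 := by ring
  rcases le_total a b with h | h
  · exact (key a b h).trans le_add_self
  · rw [add_comm a b]; exact (key b a h).trans le_self_add

lemma tsum_sq_le (b : ℤ → ℝ≥0∞) : ∑' k, b k ^ 2 ≤ (∑' k, b k) ^ 2 := by
  rw [sq, ← ENNReal.tsum_mul_right]
  refine ENNReal.tsum_le_tsum fun k => ?_
  rw [sq]
  gcongr
  exact ENNReal.le_tsum k

/-- good part -/
def gfun (u : ℕ) (f : (Fin d → ℝ) → ℝ) (L : ℝ≥0∞) (k : ℤ) (x : Fin d → ℝ) : ℝ≥0∞ :=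
  tAv k ((Aset (fun y => ‖f y‖ₑ) L (k - u)).indicator fun y => ‖Dk d (k - u) f y‖ₑ) x

/-- bad part -/
def bfun (u : ℕ) (f : (Fin d → ℝ) → ℝ) (L : ℝ≥0∞) (k : ℤ) (x : Fin d → ℝ) : ℝ≥0∞ :=
  tAv k ((⋃ n ∈ Finset.range u, Mset (fun y => ‖f y‖ₑ) L (k - u + n)).indicator
    fun y => ‖Dk d (k - u) f y‖ₑ) x

lemma measurableSet_bad (F : (Fin d → ℝ) → ℝ≥0∞) (L : ℝ≥0∞) (u : ℕ) (j : ℤ) :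
    MeasurableSet (⋃ n ∈ Finset.range u, Mset F L (j + n)) :=
  Finset.measurableSet_biUnion _ fun _ _ => (DInv_Mset _ _ _).measurableSet

lemma lintegral_good {f : (Fin d → ℝ) → ℝ} (hf : Integrable f) (L : ℝ≥0∞) (u : ℕ) :
    ∫⁻ x, ∑' k, gfun u f L k x ^ 2 ≤ (1 + 2 ^ d) * L * ∫⁻ x, ‖f x‖ₑ := by
  rw [lintegral_tsum (f := fun k x => gfun u f L k x ^ 2) fun k => ((measurable_tAv _ _).pow_const 2).aemeasurable]
  refine le_trans ?_ (good_tsum hf L)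
  have := (Equiv.subRight (u : ℤ)).tsum_eq
    (fun j => ∫⁻ x in Aset (fun y => ‖f y‖ₑ) L j, ‖Dk d j f x‖ₑ ^ 2)
  simp only [Equiv.subRight_apply] at this
  rw [← this]
  refine ENNReal.tsum_le_tsum fun k => ?_
  have hA := (DInv_Aset (fun y => ‖f y‖ₑ) L (k - u)).measurableSet
  have hm : Measurable ((Aset (fun y => ‖f y‖ₑ) L (k - u)).indicator
      fun y => ‖Dk d (k - u) f y‖ₑ) := (measurable_Dk _ f).enorm.indicator hA
  calc _ ≤ _ := lintegral_mono fun x => tAv_sq_le k hm.aemeasurable x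
    _ = _ := lintegral_tAv k (hm.pow_const 2).aemeasurable
    _ = _ := by
      rw [← lintegral_indicator hA]
      congr 1
      funext x
      by_cases hx : x ∈ Aset (fun y => ‖f y‖ₑ) L (k - u) <;> simp [hx]

lemma lintegral_bad {f : (Fin d → ℝ) → ℝ} (hf : Integrable f) (L : ℝ≥0∞) (u : ℕ) :
    ∫⁻ x, ∑' k, bfun u f L k x ≤ 2 * u * ∫⁻ x, ‖f x‖ₑ := by
  rw [lintegral_tsum (f := fun k x => bfun u f L k x) fun k => (measurable_tAv _ _).aemeasurable]
  refine le_trans (le_of_eq ?_) (bad_tsum hf L u)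
  congr 1
  funext k
  have hA := measurableSet_bad (fun y => ‖f y‖ₑ) L u (k - u)
  simp only [bfun]
  rw [lintegral_tAv k ((measurable_Dk _ f).enorm.indicator hA).aemeasurable,
    lintegral_indicator hA]

lemma tAv_split (hd : d ≠ 0) {f : (Fin d → ℝ) → ℝ} (hf : Integrable f) {L : ℝ≥0∞} (hL : L ≠ 0)
    (u : ℕ) {x : Fin d → ℝ} (hx : x ∉ ⋃ j, Oset (fun y => ‖f y‖ₑ) L j) (k : ℤ) :
    tAv k (fun y => ‖Dk d (k - u) f y‖ₑ) x ≤ gfun u f L k x + bfun u f L k x := by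
  have hA := (DInv_Aset (fun y => ‖f y‖ₑ) L (k - u)).measurableSet
  simp only [gfun, bfun, tAv, lav]
  rw [← mul_add, ← lintegral_add_left ((measurable_Dk _ f).enorm.indicator hA)]
  refine mul_le_mul_right ?_ _
  refine setLIntegral_mono' (measurableSet_tri k x) fun y hy => ?_
  by_cases hyA : y ∈ Aset (fun y => ‖f y‖ₑ) L (k - u)
  · rw [Set.indicator_of_mem hyA]; exact le_self_add
  · obtain ⟨i, hi, hyM⟩ := exists_Mset hd (fun y => ‖f y‖ₑ) L hL hf.2.ne hyA
    have hik : i < k := by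
      by_contra! h
      exact hx (Set.mem_iUnion.2 ⟨i, y, tri_mono h hy, hyM⟩)
    have : y ∈ ⋃ n ∈ Finset.range u, Mset (fun y => ‖f y‖ₑ) L (k - u + n) := by
      simp only [Set.mem_iUnion, Finset.mem_range, exists_prop]
      refine ⟨(i - (k - u)).toNat, by omega, ?_⟩
      rwa [show k - (u : ℤ) + (((i - (k - u)).toNat : ℕ) : ℤ) = i by omega]
    rw [Set.indicator_of_mem this]; exact le_add_self

lemma sq_le_tsum {f : (Fin d → ℝ) → ℝ} (u : ℕ) {lam : ℝ} (hlam : 0 < lam)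
    {x : Fin d → ℝ} (hx : lam < squareFn d u f x) :
    ENNReal.ofReal lam ^ 2 ≤ ∑' k : ℤ, tAv k (fun y => ‖Dk d (k - u) f y‖ₑ) x ^ 2 := by
  rw [squareFn, Real.lt_sqrt hlam.le] at hx
  have hs : Summable fun k : ℤ =>
      (savg d (dTri d k (dIdx d k x)) (fun y => |Dk d (k - (u : ℤ)) f y|)) ^ 2 := by
    by_contra h
    rw [tsum_eq_zero_of_not_summable h] at hx
    nlinarith
  rw [← ENNReal.ofReal_pow hlam.le]
  refine (ENNReal.ofReal_le_ofReal hx.le).trans ?_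
  rw [ENNReal.ofReal_tsum_of_nonneg (fun k => sq_nonneg _) hs]
  refine ENNReal.tsum_le_tsum fun k => ?_
  rw [← enorm_sq_eq]
  gcongr
  refine (enorm_savg_le _ _ (volume_tri k x) (tvol_ne_zero k) _).trans (le_of_eq ?_)
  simp only [Real.enorm_abs]
  rfl

lemma subset_main (hd : d ≠ 0) {f : (Fin d → ℝ) → ℝ} (hf : Integrable f) (u : ℕ) {lam : ℝ}
    (hlam : 0 < lam) :
    {x | lam < squareFn d u f x} ⊆ (⋃ j, Oset (fun y => ‖f y‖ₑ) (ENNReal.ofReal lam) j) ∪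
      ({x | ENNReal.ofReal lam ^ 2 ≤ 8 * ∑' k, gfun u f (ENNReal.ofReal lam) k x ^ 2} ∪
       {x | ENNReal.ofReal lam ≤ 4 * ∑' k, bfun u f (ENNReal.ofReal lam) k x}) := by
  intro x hx
  by_cases hxO : x ∈ ⋃ j, Oset (fun y => ‖f y‖ₑ) (ENNReal.ofReal lam) j
  · exact Or.inl hxO
  right
  set L := ENNReal.ofReal lam with hLdef
  have hL : L ≠ 0 := by simpa [hLdef] using hlam
  have h1 : L ^ 2 ≤ 4 * (∑' k, gfun u f L k x ^ 2) + 4 * ∑' k, bfun u f L k x ^ 2 := by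
    refine (sq_le_tsum u hlam hx).trans ?_
    rw [← ENNReal.tsum_mul_left, ← ENNReal.tsum_mul_left, ← ENNReal.tsum_add]
    refine ENNReal.tsum_le_tsum fun k => ?_
    exact (pow_le_pow_left' (tAv_split hd hf hL u hxO k) 2).trans (enn_add_sq_le _ _)
  rcases le_total (∑' k, bfun u f L k x ^ 2) (∑' k, gfun u f L k x ^ 2) with h | h
  · left
    show L ^ 2 ≤ 8 * _
    calc L ^ 2 ≤ _ := h1
      _ ≤ 4 * (∑' k, gfun u f L k x ^ 2) + 4 * (∑' k, gfun u f L k x ^ 2) := by gcongr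
      _ = _ := by ring
  · right
    show L ≤ 4 * _
    have : L ^ 2 ≤ (4 * ∑' k, bfun u f L k x) ^ 2 := by
      calc L ^ 2 ≤ _ := h1
        _ ≤ 4 * (∑' k, bfun u f L k x ^ 2) + 4 * (∑' k, bfun u f L k x ^ 2) := by gcongr
        _ = 8 * (∑' k, bfun u f L k x ^ 2) := by ring
        _ ≤ 16 * (∑' k, bfun u f L k x) ^ 2 := by
          gcongr
          · norm_num
          · exact tsum_sq_le _
        _ = _ := by ring
    exact (ENNReal.pow_right_strictMono (n := 2) (by norm_num)).le_iff_le.1 this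

lemma weak_enn (hd : d ≠ 0) {f : (Fin d → ℝ) → ℝ} (hf : Integrable f) (u : ℕ) {lam : ℝ}
    (hlam : 0 < lam) :
    ENNReal.ofReal lam * volume {x | lam < squareFn d u f x} ≤
      (3 ^ d + 8 * (1 + 2 ^ d) + 8 * u) * ∫⁻ x, ‖f x‖ₑ := by
  have hF : AEMeasurable (fun y => ‖f y‖ₑ) := hf.1.aemeasurable.enorm
  have hsub := subset_main hd hf u hlam
  set L := ENNReal.ofReal lam with hLdef
  have hL : L ≠ 0 := by simpa [hLdef] using hlam
  have hLt : L ≠ ⊤ := by simp [hLdef]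
  have hg : L * volume {x | L ^ 2 ≤ 8 * ∑' k, gfun u f L k x ^ 2} ≤
      8 * (1 + 2 ^ d) * ∫⁻ x, ‖f x‖ₑ := by
    have hm : Measurable fun x => ∑' k, gfun u f L k x ^ 2 :=
      Measurable.tsum fun k => (measurable_tAv _ _).pow_const 2
    have h1 := mul_meas_ge_le_lintegral (μ := volume) (hm.const_mul 8) (L ^ 2)
    rw [lintegral_const_mul _ hm] at h1
    have h2 : L * (L * volume {x | L ^ 2 ≤ 8 * ∑' k, gfun u f L k x ^ 2}) ≤
        L * (8 * (1 + 2 ^ d) * ∫⁻ x, ‖f x‖ₑ) := by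
      calc _ = L ^ 2 * volume {x | L ^ 2 ≤ 8 * ∑' k, gfun u f L k x ^ 2} := by ring
        _ ≤ _ := h1
        _ ≤ 8 * ((1 + 2 ^ d) * L * ∫⁻ x, ‖f x‖ₑ) := by gcongr; exact lintegral_good hf L u
        _ = _ := by ring
    exact (ENNReal.mul_le_mul_iff_right hL hLt).1 h2
  have hb : L * volume {x | L ≤ 4 * ∑' k, bfun u f L k x} ≤ 8 * u * ∫⁻ x, ‖f x‖ₑ := by
    have hm : Measurable fun x => ∑' k, bfun u f L k x :=
      Measurable.tsum fun k => measurable_tAv _ _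
    have h1 := mul_meas_ge_le_lintegral (μ := volume) (hm.const_mul 4) L
    rw [lintegral_const_mul _ hm] at h1
    calc _ ≤ _ := h1
      _ ≤ 4 * (2 * u * ∫⁻ x, ‖f x‖ₑ) := by gcongr; exact lintegral_bad hf L u
      _ = _ := by ring
  calc _ ≤ L * (volume (⋃ j, Oset (fun y => ‖f y‖ₑ) L j) +
        (volume {x | L ^ 2 ≤ 8 * ∑' k, gfun u f L k x ^ 2} +
          volume {x | L ≤ 4 * ∑' k, bfun u f L k x})) := by
        gcongr
        exact (measure_mono hsub).trans ((measure_union_le _ _).trans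
          (add_le_add_right (measure_union_le _ _) _))
    _ = L * volume (⋃ j, Oset (fun y => ‖f y‖ₑ) L j) +
        (L * volume {x | L ^ 2 ≤ 8 * ∑' k, gfun u f L k x ^ 2} +
          L * volume {x | L ≤ 4 * ∑' k, bfun u f L k x}) := by ring
    _ ≤ _ := add_le_add (volume_O_le hF L) (add_le_add hg hb)
    _ = _ := by ring

lemma squareFn_zero_dim (u : ℕ) (f : (Fin 0 → ℝ) → ℝ) (x : Fin 0 → ℝ) :
    squareFn 0 u f x = 0 := by
  have h (k : ℤ) (m : Fin 0 → ℤ) : dSet 0 k m = univ := by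
    ext y; simp [dSet]
  simp [squareFn, Dk, Ek, savg, h]

end helpers

/-- Weak-type `(1,1)` bound for the complexity-`u` square
function: `‖S_u f‖_{L^{1,∞}} ≲ (1+u) ‖f‖₁`. -/
theorem square_function_weak_type (d : ℕ) :
    ∃ C : ℝ, 0 < C ∧
      ∀ (u : ℕ) (f : (Fin d → ℝ) → ℝ), Integrable f volume →
        ∀ lam : ℝ, 0 < lam →
          ENNReal.ofReal lam * volume {x | lam < squareFn d u f x} ≤
            ENNReal.ofReal (C * (1 + (u : ℝ)) * ∫ x, |f x|) := by
  refine ⟨3 ^ d + 8 * (1 + 2 ^ d) + 8, by positivity, fun u f hf lam hlam => ?_⟩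
  rcases eq_or_ne d 0 with rfl | hd
  · have : {x | lam < squareFn 0 u f x} = ∅ := by
      ext x
      simp [squareFn_zero_dim, hlam.le]
    rw [this]; simp
  · refine (weak_enn hd hf u hlam).trans ?_
    have hN : ENNReal.ofReal (∫ x, |f x|) = ∫⁻ x, ‖f x‖ₑ :=
      ofReal_integral_norm_eq_lintegral_enorm hf
    rw [ENNReal.ofReal_mul (by positivity), hN]
    gcongr
    have : (3 ^ d + 8 * (1 + 2 ^ d) + 8 * (u : ℝ≥0∞)) =
        ENNReal.ofReal (3 ^ d + 8 * (1 + 2 ^ d) + 8 * (u : ℝ)) := by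
      rw [ENNReal.ofReal_add (by positivity) (by positivity),
        ENNReal.ofReal_add (by positivity) (by positivity),
        ENNReal.ofReal_mul (by positivity), ENNReal.ofReal_mul (by positivity),
        ENNReal.ofReal_add (by positivity) (by positivity),
        ENNReal.ofReal_pow (by positivity), ENNReal.ofReal_pow (by positivity)]
      simp
    rw [this]
    refine ENNReal.ofReal_le_ofReal ?_
    have h1 : (0 : ℝ) ≤ (3 ^ d + 8 * (1 + 2 ^ d)) * u := by positivity
    nlinarith
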